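/- Let b ∈ ℝ and suppose that min Σ_b(U) ≤ 0 for every upper set U of X (i.e., the empty set is a maximal upper set with respect to b). Then for every upper set U of X and all reals b₁, b₂ with b ≤ b₁ ≤ b₂, one has Σ_{x∈U} ℓ(g(x), b₁) ≤ Σ_{x∈U} ℓ(g(x), b₂). -/

import Mathlib

open Pointwise Finset
open scoped Classical

variable {X : Type*}

/-- `f` is isotonic on the subset `S` of `X`. -/
def IsotonicOn [PartialOrder X] (f : X → ℝ) (S : Finset X) : Prop :=
  ∀ x ∈ S, ∀ y ∈ S, x ≤ y → f x ≤ f y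

/-- The separable loss `J_S(g, f) = Σ_{x∈S} ℓ(g(x), f(x))`. -/
noncomputable def lossJ (ℓ : ℝ → ℝ → ℝ) (g : X → ℝ) (S : Finset X) (f : X → ℝ) : ℝ :=
  ∑ x ∈ S, ℓ (g x) (f x)

/-- The subdifferential of the convex function `ℓ(a, ·)` at `b`. -/
def subdiff (ℓ : ℝ → ℝ → ℝ) (a b : ℝ) : Set ℝ :=
  {s : ℝ | ∀ y : ℝ, ℓ a b + s * (y - b) ≤ ℓ a y}

/-- `Σ_b(S) = −Σ_{x∈S} ∂ℓ(g(x), b)` (Minkowski sum; `Σ_b(∅) = {0}`). -/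
noncomputable def SigmaSet (ℓ : ℝ → ℝ → ℝ) (g : X → ℝ) (b : ℝ) (S : Finset X) : Set ℝ :=
  -∑ x ∈ S, subdiff ℓ (g x) b

/-- `U` is an upper set of `X`. -/
def IsUpperFinset [PartialOrder X] (U : Finset X) : Prop :=
  ∀ x ∈ U, ∀ y : X, x ≤ y → y ∈ U

/-- `L` is a lower set of `X`. -/
def IsLowerFinset [PartialOrder X] (L : Finset X) : Prop :=
  ∀ y ∈ L, ∀ x : X, x ≤ y → x ∈ L

/-- `U` is a maximal upper set with respect to `b`:
it maximizes `min Σ_b(U')` over all upper sets `U'`. -/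
def IsMaxUpper [PartialOrder X] (ℓ : ℝ → ℝ → ℝ) (g : X → ℝ) (b : ℝ) (U : Finset X) : Prop :=
  IsUpperFinset U ∧ ∀ U' : Finset X, IsUpperFinset U' →
    sInf (SigmaSet ℓ g b U') ≤ sInf (SigmaSet ℓ g b U)

/-- `L` is a minimal lower set with respect to `b`:
it minimizes `max Σ_b(L')` over all lower sets `L'`. -/
def IsMinLower [PartialOrder X] (ℓ : ℝ → ℝ → ℝ) (g : X → ℝ) (b : ℝ) (L : Finset X) : Prop :=
  IsLowerFinset L ∧ ∀ L' : Finset X, IsLowerFinset L' →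
    sSup (SigmaSet ℓ g b L) ≤ sSup (SigmaSet ℓ g b L')

/-- A convex function on the line has a subgradient at every point. -/
theorem subdiff_nonempty {ℓ : ℝ → ℝ → ℝ} {a : ℝ}
    (h : ConvexOn ℝ (Set.univ : Set ℝ) (ℓ a)) (b : ℝ) : (subdiff ℓ a b).Nonempty := by
  have hb : b ∈ interior (Set.univ : Set ℝ) := by simp
  refine ⟨derivWithin (ℓ a) (Set.Ioi b) b, fun y => ?_⟩
  rcases lt_trichotomy y b with hy | rfl | hy
  · have hs := (h.slope_le_leftDeriv_of_mem_interior (Set.mem_univ y) hb hy).trans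
      (h.leftDeriv_le_rightDeriv_of_mem_interior hb)
    rw [slope_def_field, div_le_iff₀ (sub_pos.2 hy)] at hs
    linarith
  · simp
  · have hs := h.rightDeriv_le_slope_of_mem_interior hb (Set.mem_univ y) hy
    rw [slope_def_field, le_div_iff₀ (sub_pos.2 hy)] at hs
    linarith

theorem SigmaSet_nonempty {ℓ : ℝ → ℝ → ℝ}
    (hconv : ∀ a : ℝ, ConvexOn ℝ (Set.univ : Set ℝ) (ℓ a)) (g : X → ℝ) (b : ℝ) (S : Finset X) :
    (SigmaSet ℓ g b S).Nonempty := by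
  choose s hs using fun x : X => subdiff_nonempty (hconv (g x)) b
  exact Set.Nonempty.neg ⟨∑ x ∈ S, s x, Set.finsetSum_mem_finsetSum S _ _ fun x _ => hs x⟩

/-- Elements of `-Σ_b(S)` are subgradients at `b` of `∑ x ∈ S, ℓ (g x)`. -/
theorem sum_sub_mul_le_of_mem_SigmaSet {ℓ : ℝ → ℝ → ℝ} {g : X → ℝ} {b t : ℝ} {S : Finset X}
    (ht : t ∈ SigmaSet ℓ g b S) (y : ℝ) :
    ∑ x ∈ S, ℓ (g x) b - t * (y - b) ≤ ∑ x ∈ S, ℓ (g x) y := by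
  obtain ⟨s, hs, hsum⟩ := Set.mem_finsetSum S _ _ |>.1 (Set.mem_neg.1 ht)
  have hle := Finset.sum_le_sum fun x (hx : x ∈ S) => hs hx y
  rw [Finset.sum_add_distrib, ← Finset.sum_mul, hsum] at hle
  linarith

theorem sum_le_sum_of_sInf_SigmaSet_nonpos {ℓ : ℝ → ℝ → ℝ}
    (hconv : ∀ a : ℝ, ConvexOn ℝ (Set.univ : Set ℝ) (ℓ a)) {g : X → ℝ} {b y : ℝ} {S : Finset X}
    (hS : sInf (SigmaSet ℓ g b S) ≤ 0) (hy : b ≤ y) :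
    ∑ x ∈ S, ℓ (g x) b ≤ ∑ x ∈ S, ℓ (g x) y := by
  rcases hy.eq_or_lt with rfl | hy
  · rfl
  refine le_of_forall_pos_le_add fun ε hε => ?_
  obtain ⟨t, ht, htε⟩ := exists_lt_of_csInf_lt (SigmaSet_nonempty hconv g b S)
    (hS.trans_lt (div_pos hε (sub_pos.2 hy)))
  rw [lt_div_iff₀ (sub_pos.2 hy)] at htε
  linarith [sum_sub_mul_le_of_mem_SigmaSet ht y]

/-- If `min Σ_b(U) ≤ 0` for every upper set `U` of `X`, then for every
upper set `U` and all `b ≤ b₁ ≤ b₂`, `Σ_{x∈U} ℓ(g(x), b₁) ≤ Σ_{x∈U} ℓ(g(x), b₂)`. -/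
theorem upper_set_loss_monotone_above
    [Fintype X] [Nonempty X] [PartialOrder X]
    (ℓ : ℝ → ℝ → ℝ) (hconv : ∀ a : ℝ, ConvexOn ℝ (Set.univ : Set ℝ) (ℓ a))
    (g : X → ℝ) (b : ℝ)
    (hmax : ∀ U : Finset X, IsUpperFinset U → sInf (SigmaSet ℓ g b U) ≤ 0) :
    ∀ U : Finset X, IsUpperFinset U → ∀ b₁ b₂ : ℝ, b ≤ b₁ → b₁ ≤ b₂ →
      ∑ x ∈ U, ℓ (g x) b₁ ≤ ∑ x ∈ U, ℓ (g x) b₂ := by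
  intro U hU b₁ b₂ h₁ h₂
  have hsum : ConvexOn ℝ (Set.univ : Set ℝ) fun y => ∑ x ∈ U, ℓ (g x) y := by
    simpa only [Finset.sum_fn] using Finset.sum_induction (fun x => ℓ (g x))
      (ConvexOn ℝ (Set.univ : Set ℝ)) (fun _ _ => ConvexOn.add)
      (convexOn_const 0 convex_univ) fun x _ => hconv (g x)
  have hb := sum_le_sum_of_sInf_SigmaSet_nonpos hconv (hmax U hU) (h₁.trans h₂)
  exact (hsum.le_max_of_mem_Icc (Set.mem_univ b) (Set.mem_univ b₂) ⟨h₁, h₂⟩).trans_eq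
    (max_eq_right hb)
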